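/- arXiv:2508.17100 — 2 statements merged into one kernel-verified Lean document; each statement's English description precedes it below -/
import Mathlib

section
/- Let R be a Hermite ring with the D-property. Then R is an elementary divisor ring if and only if every matrix A = (a_ij) over R satisfying Σ_{i,j} R a_ij R = R admits a diagonal reduction, i.e. there exist invertible matrices P, Q of suitable sizes with PAQ = diag(d₁, …, d_k, 0, …, 0) where R d_{i+1} R ⊆ d_i R ∩ R d_i for each i = 1, …, k−1. -/
open Matrix

section Defs

variable {R : Type*} [Ring R]

/-- The two-sided ideal `A_*` generated by the entries of a matrix (the "coboundary"). -/
def matStar {m n : ℕ} (A : Matrix (Fin m) (Fin n) R) : TwoSidedIdeal R :=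
  TwoSidedIdeal.span {x : R | ∃ i j, A i j = x}

/-- Two matrices are equivalent if `A = P * B * Q` for invertible `P`, `Q`. -/
def MatEquiv {m n : ℕ} (A B : Matrix (Fin m) (Fin n) R) : Prop :=
  ∃ (P : Matrix (Fin m) (Fin m) R) (Q : Matrix (Fin n) (Fin n) R),
    IsUnit P ∧ IsUnit Q ∧ A = P * B * Q

/-- A nonzero element `a` is duo if `aR = Ra`. -/
def IsDuoElem (a : R) : Prop :=
  a ≠ 0 ∧ ∀ x : R, (∃ r, x = a * r) ↔ ∃ s, x = s * a

/-- Dubrovin's property: for each `a` the two-sided ideal `RaR` is principal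
as a right ideal and as a left ideal, with a common generator. -/
def DProp (R : Type*) [Ring R] : Prop :=
  ∀ a : R, ∃ b : R,
    (∀ x : R, x ∈ TwoSidedIdeal.span {a} ↔ ∃ r, x = b * r) ∧
    (∀ x : R, (∃ r, x = b * r) ↔ ∃ s, x = s * b)

/-- Komarnytsky's property: every factor of a duo element is a duo element. -/
def KProp (R : Type*) [Ring R] : Prop :=
  ∀ a z : R, IsDuoElem a → (∃ u v, a = u * z * v) → IsDuoElem z

/-- Dubrovin–Komarnytsky property. -/
def DKProp (R : Type*) [Ring R] : Prop := DProp R ∧ KProp R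

/-- A (possibly rectangular) matrix is of the form `diag(d₁, …, d_k, 0, …, 0)`
with `R d_{i+1} R ⊆ d_i R ∩ R d_i` for consecutive diagonal entries. -/
def IsTotalDivisorDiag {m n : ℕ} (D : Matrix (Fin m) (Fin n) R) : Prop :=
  (∀ (i : Fin m) (j : Fin n), (i : ℕ) ≠ (j : ℕ) → D i j = 0) ∧
  (∀ (i : Fin m) (j : Fin n) (i' : Fin m) (j' : Fin n),
    (i : ℕ) = (j : ℕ) → (i' : ℕ) = (j' : ℕ) → (i' : ℕ) = (i : ℕ) + 1 →
    ∀ x ∈ TwoSidedIdeal.span {D i' j'},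
      (∃ r, x = D i j * r) ∧ (∃ s, x = s * D i j))

/-- Elementary divisor ring. -/
def IsEDRing (R : Type*) [Ring R] : Prop :=
  ∀ (m n : ℕ) (A : Matrix (Fin m) (Fin n) R),
    ∃ (P : Matrix (Fin m) (Fin m) R) (Q : Matrix (Fin n) (Fin n) R),
      IsUnit P ∧ IsUnit Q ∧ IsTotalDivisorDiag (P * A * Q)

/-- Diagonal reduction of the `EDK` type: additionally every diagonal entry with a
nonzero diagonal successor (i.e. each of `ε₁, …, ε_{k-1}`) is a duo element. -/
def IsEDKDiag {m n : ℕ} (D : Matrix (Fin m) (Fin n) R) : Prop :=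
  IsTotalDivisorDiag D ∧
  (∀ (i : Fin m) (j : Fin n) (i' : Fin m) (j' : Fin n),
    (i : ℕ) = (j : ℕ) → (i' : ℕ) = (j' : ℕ) → (i' : ℕ) = (i : ℕ) + 1 →
    D i' j' ≠ 0 → IsDuoElem (D i j))

/-- Elementary Dubrovin–Komarnytsky property. -/
def EDKProp (R : Type*) [Ring R] : Prop :=
  ∀ (m n : ℕ) (A : Matrix (Fin m) (Fin n) R),
    ∃ (P : Matrix (Fin m) (Fin m) R) (Q : Matrix (Fin n) (Fin n) R),
      IsUnit P ∧ IsUnit Q ∧ IsEDKDiag (P * A * Q)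

/-- Bézout ring: every finitely generated right ideal and every finitely
generated left ideal is principal. -/
def IsBezoutRing (R : Type*) [Ring R] : Prop :=
  (∀ I : Ideal Rᵐᵒᵖ, I.FG → ∃ d, I = Ideal.span {d}) ∧
  (∀ I : Ideal R, I.FG → ∃ d, I = Ideal.span {d})

/-- Stable range `1`: `aR + bR = R` implies `(a + bt)R = R` for some `t`. -/
def StableRangeOne (R : Type*) [Ring R] : Prop :=
  ∀ a b : R, (∃ x y, a * x + b * y = 1) → ∃ t u, (a + b * t) * u = 1

/-- Right Hermite ring: every `1 × 2` matrix admits a diagonal reduction. -/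
def IsRightHermite (R : Type*) [Ring R] : Prop :=
  ∀ a b : R, ∃ (P : Matrix (Fin 2) (Fin 2) R) (c : R),
    IsUnit P ∧ Matrix.of ![![a, b]] * P = Matrix.of ![![c, 0]]

/-- Left Hermite ring: every `2 × 1` matrix admits a diagonal reduction. -/
def IsLeftHermite (R : Type*) [Ring R] : Prop :=
  ∀ a b : R, ∃ (Q : Matrix (Fin 2) (Fin 2) R) (d : R),
    IsUnit Q ∧ Q * Matrix.of ![![a], ![b]] = Matrix.of ![![d], ![0]]

/-- Hermite ring. -/
def IsHermiteRing (R : Type*) [Ring R] : Prop := IsRightHermite R ∧ IsLeftHermite R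

/-- Quasi-duo: every maximal right ideal and every maximal left ideal is two-sided. -/
def QuasiDuo (R : Type*) [Ring R] : Prop :=
  (∀ I : Ideal R, I.IsMaximal → ∀ x ∈ I, ∀ r : R, x * r ∈ I) ∧
  (∀ I : Ideal Rᵐᵒᵖ, I.IsMaximal → ∀ x ∈ I, ∀ r : Rᵐᵒᵖ, x * r ∈ I)

/-- `a` is 2-simple: `u₁av₁ + u₂av₂ = 1` for some `uᵢ, vᵢ`, and `n = 2` is minimal. -/
def TwoSimple (a : R) : Prop :=
  (∃ u₁ v₁ u₂ v₂ : R, u₁ * a * v₁ + u₂ * a * v₂ = 1) ∧ ¬ ∃ u v : R, u * a * v = 1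

/-- A nonzero element is finite if every right ideal and every left ideal
containing it is principal. -/
def FiniteElem (a : R) : Prop :=
  a ≠ 0 ∧
  (∀ I : Ideal Rᵐᵒᵖ, MulOpposite.op a ∈ I → ∃ d, I = Ideal.span {d}) ∧
  (∀ I : Ideal R, a ∈ I → ∃ d, I = Ideal.span {d})

end Defs

namespace HermiteReduction

section PlaneMatrix

variable {n R : Type*} [Fintype n] [DecidableEq n] [Ring R]

/-- The `n × n` matrix acting as `Q` on the coordinates `i`, `j` and as the identity on the
other ones. -/
def planeMatrix (i j : n) (Q : Matrix (Fin 2) (Fin 2) R) : Matrix n n R :=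
  (1 : Matrix n n R).submatrix id ![i, j] * (Q - 1) * (1 : Matrix n n R).submatrix ![i, j] id + 1

lemma submatrix_one_mul_submatrix_one {i j : n} (hij : i ≠ j) :
    (1 : Matrix n n R).submatrix ![i, j] id * (1 : Matrix n n R).submatrix id ![i, j] = 1 := by
  ext a b
  revert a b
  simp [Fin.forall_fin_two, -Matrix.submatrix_cons_row, Matrix.mul_apply, Matrix.one_apply, hij,
    hij.symm]

lemma planeMatrix_mul {i j : n} (hij : i ≠ j) (Q Q' : Matrix (Fin 2) (Fin 2) R) :
    planeMatrix i j Q * planeMatrix i j Q' = planeMatrix i j (Q * Q') := by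
  have h := submatrix_one_mul_submatrix_one (R := R) hij
  unfold planeMatrix
  set S := (1 : Matrix n n R).submatrix id ![i, j]
  set T := (1 : Matrix n n R).submatrix ![i, j] id
  have h1 : S * (Q - 1) * T * (S * (Q' - 1) * T) = S * ((Q - 1) * (Q' - 1)) * T := by
    calc _ = S * (Q - 1) * (T * S) * (Q' - 1) * T := by simp only [Matrix.mul_assoc]
      _ = _ := by rw [h]; simp only [Matrix.mul_assoc, Matrix.one_mul]
  have h2 : Q * Q' - 1 = (Q - 1) * (Q' - 1) + (Q - 1) + (Q' - 1) := by noncomm_ring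
  rw [h2, add_mul, mul_add, h1]
  simp only [Matrix.mul_add, Matrix.add_mul, Matrix.mul_one, Matrix.one_mul]
  abel

lemma isUnit_planeMatrix {i j : n} (hij : i ≠ j) {Q : Matrix (Fin 2) (Fin 2) R}
    (hQ : IsUnit Q) : IsUnit (planeMatrix i j Q) := by
  obtain ⟨Q', h, h'⟩ := isUnit_iff_exists.1 hQ
  have h1 : planeMatrix i j (1 : Matrix (Fin 2) (Fin 2) R) = 1 := by
    rw [planeMatrix, sub_self, Matrix.mul_zero, Matrix.zero_mul, zero_add]
  exact isUnit_iff_exists.2 ⟨planeMatrix i j Q', by rw [planeMatrix_mul hij, h, h1],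
    by rw [planeMatrix_mul hij, h', h1]⟩

lemma planeMatrix_mulVec (i j : n) (Q : Matrix (Fin 2) (Fin 2) R) (v : n → R) :
    planeMatrix i j Q *ᵥ v =
      (1 : Matrix n n R).submatrix id ![i, j] *ᵥ (Q *ᵥ ![v i, v j] - ![v i, v j]) + v := by
  have : (1 : Matrix n n R).submatrix ![i, j] id *ᵥ v = ![v i, v j] := by
    ext a
    revert a
    simp [Fin.forall_fin_two, -Matrix.submatrix_cons_row, Matrix.mulVec, dotProduct,
      Matrix.one_apply]
  rw [planeMatrix, Matrix.add_mulVec, Matrix.one_mulVec, ← Matrix.mulVec_mulVec,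
    ← Matrix.mulVec_mulVec, this, Matrix.sub_mulVec, Matrix.one_mulVec]

lemma planeMatrix_mulVec_left {i j : n} (hij : i ≠ j) (Q : Matrix (Fin 2) (Fin 2) R)
    (v : n → R) : (planeMatrix i j Q *ᵥ v) i = (Q *ᵥ ![v i, v j]) 0 := by
  rw [planeMatrix_mulVec, Pi.add_apply]
  generalize Q *ᵥ ![v i, v j] = w
  simp [Matrix.mulVec, dotProduct, Matrix.one_apply, hij]

lemma planeMatrix_mulVec_right {i j : n} (hij : i ≠ j) (Q : Matrix (Fin 2) (Fin 2) R)
    (v : n → R) : (planeMatrix i j Q *ᵥ v) j = (Q *ᵥ ![v i, v j]) 1 := by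
  rw [planeMatrix_mulVec, Pi.add_apply]
  generalize Q *ᵥ ![v i, v j] = w
  simp [Matrix.mulVec, dotProduct, Matrix.one_apply, hij.symm]

lemma planeMatrix_mulVec_of_ne {i j k : n} (hi : k ≠ i) (hj : k ≠ j)
    (Q : Matrix (Fin 2) (Fin 2) R) (v : n → R) : (planeMatrix i j Q *ᵥ v) k = v k := by
  rw [planeMatrix_mulVec, Pi.add_apply]
  generalize Q *ᵥ ![v i, v j] = w
  simp [Matrix.mulVec, dotProduct, Matrix.one_apply, hi, hj]

lemma vecMul_planeMatrix_right {i j : n} (hij : i ≠ j) (Q : Matrix (Fin 2) (Fin 2) R)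
    (v : n → R) : (v ᵥ* planeMatrix i j Q) j = (![v i, v j] ᵥ* Q) 1 := by
  have : v ᵥ* (1 : Matrix n n R).submatrix id ![i, j] = ![v i, v j] := by
    ext a
    revert a
    simp [Fin.forall_fin_two, Matrix.vecMul, dotProduct, Matrix.one_apply]
  rw [planeMatrix, Matrix.vecMul_add, Matrix.vecMul_one, ← Matrix.vecMul_vecMul,
    ← Matrix.vecMul_vecMul, this, Matrix.vecMul_sub, Matrix.vecMul_one, Pi.add_apply]
  generalize ![v i, v j] ᵥ* Q = w
  simp [Matrix.vecMul, dotProduct, Matrix.one_apply, hij]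

lemma map_planeMatrix {S : Type*} [Ring S] (f : R →+* S) (i j : n)
    (Q : Matrix (Fin 2) (Fin 2) R) :
    f.mapMatrix (planeMatrix i j Q) = planeMatrix i j (f.mapMatrix Q) := by
  simp only [planeMatrix, map_add, map_one, RingHom.mapMatrix_apply, Matrix.map_mul,
    ← Matrix.submatrix_map, Matrix.map_sub f (map_sub f)]
  simp

end PlaneMatrix

section Columns

variable {n R S : Type*} [Fintype n] [DecidableEq n] [Ring R] [Ring S]

lemma exists_isUnit_mulVec_eq_zero (hR : IsLeftHermite R) (i : n) (v : n → R) :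
    ∃ Y : Matrix n n R, IsUnit Y ∧ ∀ j, j ≠ i → (Y *ᵥ v) j = 0 := by
  suffices ∀ s : Finset n, i ∉ s →
      ∃ Y : Matrix n n R, IsUnit Y ∧ ∀ j ∈ s, (Y *ᵥ v) j = 0 by
    obtain ⟨Y, hY, h⟩ := this (Finset.univ.erase i) (by simp)
    exact ⟨Y, hY, fun j hj => h j (by simp [hj])⟩
  intro s
  induction s using Finset.induction_on with
  | empty => exact fun _ => ⟨1, isUnit_one, by simp⟩
  | insert k s hk ih =>
    intro hi
    rw [Finset.mem_insert, not_or] at hi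
    obtain ⟨Y, hY, h⟩ := ih hi.2
    obtain ⟨Q, d, hQ, hd⟩ := hR ((Y *ᵥ v) i) ((Y *ᵥ v) k)
    refine ⟨planeMatrix i k Q * Y, (isUnit_planeMatrix hi.1 hQ).mul hY, fun j hj => ?_⟩
    rw [← Matrix.mulVec_mulVec]
    obtain rfl | hjk := eq_or_ne j k
    · rw [planeMatrix_mulVec_right hi.1]
      simpa [Matrix.mul_apply, Matrix.mulVec, dotProduct, Fin.sum_univ_two] using
        congrFun (congrFun hd 1) 0
    · have hjs : j ∈ s := (Finset.mem_insert.1 hj).resolve_left hjk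
      rw [planeMatrix_mulVec_of_ne (fun h : j = i => hi.2 (h ▸ hjs)) hjk]
      exact h j hjs

/-- A left invertible column over a quotient of a left Hermite ring is carried to a standard
basis vector by the image of an invertible matrix. -/
lemma exists_isUnit_map_mulVec_eq_single (hR : IsLeftHermite R) {f : R →+* S}
    (hf : Function.Surjective f) {i k : n} (hik : i ≠ k) (x z : n → S) (hzx : z ⬝ᵥ x = 1) :
    ∃ Y : Matrix n n R, IsUnit Y ∧ f.mapMatrix Y *ᵥ x = Pi.single i 1 := by
  obtain ⟨x', hx'⟩ : ∃ x' : n → R, f ∘ x' = x := hf.comp_left x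
  obtain ⟨Y, hY, h⟩ := exists_isUnit_mulVec_eq_zero hR i x'
  obtain ⟨Z, hYZ, hZY⟩ := isUnit_iff_exists.1 hY
  set c := (Y *ᵥ x') i with hc
  have hYx' : Y *ᵥ x' = Pi.single i c := by
    ext j
    obtain rfl | hj := eq_or_ne j i
    · simp [hc]
    · simp [hj, h j hj]
  have hYx : f.mapMatrix Y *ᵥ x = Pi.single i (f c) := by
    ext j
    have := (RingHom.map_mulVec f Y x' j).symm
    rw [RingHom.mapMatrix_apply, ← hx', this, hYx']
    exact (Pi.apply_single (fun _ => f) (fun _ => map_zero f) i c j)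
  obtain ⟨s, hs⟩ : ∃ s, f (s * c) = 1 := by
    obtain ⟨s, hs⟩ := hf ((z ᵥ* f.mapMatrix Z) i)
    refine ⟨s, ?_⟩
    rw [map_mul, hs, ← dotProduct_single, ← hYx, ← Matrix.dotProduct_mulVec,
      Matrix.mulVec_mulVec, ← map_mul, hZY, map_one, Matrix.one_mulVec, hzx]
  have hM : IsUnit !![s, 1; 1 - c * s, -c] := by
    refine isUnit_iff_exists.2 ⟨!![c, 1; 1 - s * c, -s], ?_, ?_⟩ <;>
      (ext a b; fin_cases a <;> fin_cases b <;>
        (simp [Matrix.mul_apply, Fin.sum_univ_two]; try noncomm_ring))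
  refine ⟨planeMatrix i k !![s, 1; 1 - c * s, -c] * Y, (isUnit_planeMatrix hik hM).mul hY, ?_⟩
  rw [map_mul, ← Matrix.mulVec_mulVec, hYx, map_planeMatrix]
  have hcs : f c * f s * f c = f c := by rw [mul_assoc, ← map_mul f s, hs, mul_one]
  ext j
  obtain rfl | hji := eq_or_ne j i
  · rw [planeMatrix_mulVec_left hik]
    simpa [Matrix.mulVec, dotProduct, Fin.sum_univ_two, hik.symm] using hs
  · obtain rfl | hjk := eq_or_ne j k
    · rw [planeMatrix_mulVec_right hik]
      simp [Matrix.mulVec, dotProduct, Fin.sum_univ_two, hji, sub_mul, hcs]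
    · rw [planeMatrix_mulVec_of_ne hji hjk]
      simp [hji]

end Columns

section Lifting

variable {R S : Type*} [Ring R] [Ring S]

/-- Every invertible matrix over `S` is the image under `f` of an invertible matrix times an
invertible diagonal matrix. -/
def LiftsUpToDiag (n : Type*) [Fintype n] [DecidableEq n] (f : R →+* S) : Prop :=
  ∀ X : Matrix n n S, IsUnit X →
    ∃ (Y : Matrix n n R) (W : Matrix n n S),
      IsUnit Y ∧ IsUnit W ∧ W.IsDiag ∧ X = f.mapMatrix Y * W

lemma isUnit_submatrix_equiv {m n : Type*} [Fintype m] [DecidableEq m] [Fintype n]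
    [DecidableEq n] {A : Matrix n n R} (hA : IsUnit A) (e : m ≃ n) :
    IsUnit (A.submatrix e e) := by
  obtain ⟨A', h, h'⟩ := isUnit_iff_exists.1 hA
  refine isUnit_iff_exists.2 ⟨A'.submatrix e e, ?_, ?_⟩ <;>
    simp [Matrix.submatrix_mul_equiv, h, h']

lemma LiftsUpToDiag.of_equiv {m n : Type*} [Fintype m] [DecidableEq m] [Fintype n]
    [DecidableEq n] {f : R →+* S} (e : m ≃ n) (h : LiftsUpToDiag m f) : LiftsUpToDiag n f := by
  intro X hX
  obtain ⟨Y, W, hY, hW, hd, hXYW⟩ := h _ (isUnit_submatrix_equiv hX e)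
  refine ⟨Y.submatrix e.symm e.symm, W.submatrix e.symm e.symm,
    isUnit_submatrix_equiv hY e.symm, isUnit_submatrix_equiv hW e.symm,
    hd.submatrix e.symm.injective, ?_⟩
  have := congrArg (fun M => M.submatrix e.symm e.symm) hXYW
  simpa [Matrix.submatrix_map, ← Matrix.submatrix_mul_equiv _ _ _ e.symm] using this

lemma LiftsUpToDiag.sum {n : Type*} [Fintype n] [DecidableEq n] [Nonempty n] {f : R →+* S}
    (hR : IsLeftHermite R) (hf : Function.Surjective f) (h : LiftsUpToDiag n f) :
    LiftsUpToDiag (Unit ⊕ n) f := by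
  intro X hX
  obtain ⟨X', hXX', hX'X⟩ := isUnit_iff_exists.1 hX
  obtain ⟨k⟩ := ‹Nonempty n›
  obtain ⟨Y, hY, hYX⟩ := exists_isUnit_map_mulVec_eq_single hR hf
    (Sum.inl_ne_inr : (Sum.inl () : Unit ⊕ n) ≠ Sum.inr k)
    (fun a => X a (Sum.inl ())) (X' (Sum.inl ()))
    (by simpa [Matrix.mul_apply, dotProduct] using
      congrFun (congrFun hX'X (Sum.inl ())) (Sum.inl ()))
  obtain ⟨Y', hYY', hY'Y⟩ := isUnit_iff_exists.1 hY
  set M := f.mapMatrix Y * X with hM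
  have hcol : ∀ a, M a (Sum.inl ()) = Pi.single (M := fun _ => S) (Sum.inl ()) 1 a :=
    fun a => congrFun hYX a
  obtain ⟨r, D, hMrD⟩ : ∃ r D, M = fromBlocks 1 r 0 D := by
    refine ⟨M.toBlocks₁₂, M.toBlocks₂₂, ?_⟩
    conv_lhs => rw [← Matrix.fromBlocks_toBlocks M]
    congr 1
    · ext a b
      simp [Matrix.toBlocks₁₁, hcol]
    · ext a b
      simp [Matrix.toBlocks₂₁, hcol]
  have hD : IsUnit D := by
    have hMu : IsUnit M := (hY.map f.mapMatrix).mul hX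
    obtain ⟨Z, hMZ, hZM⟩ := isUnit_iff_exists.1 hMu
    rw [hMrD, ← Matrix.fromBlocks_toBlocks Z, Matrix.fromBlocks_multiply,
      ← Matrix.fromBlocks_one, Matrix.fromBlocks_inj] at hMZ hZM
    obtain ⟨-, -, -, h1⟩ := hMZ
    obtain ⟨-, -, h2, h3⟩ := hZM
    simp only [Matrix.mul_one, Matrix.mul_zero, add_zero] at h2
    simp only [h2, Matrix.zero_mul, zero_add] at h1 h3
    exact isUnit_iff_exists.2 ⟨_, h1, h3⟩
  obtain ⟨V, W, hV, hW, hdiag, hDVW⟩ := h D hD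
  obtain ⟨V', hVV', hV'V⟩ := isUnit_iff_exists.1 hV
  obtain ⟨W', hWW', hW'W⟩ := isUnit_iff_exists.1 hW
  obtain ⟨ρ, hρ⟩ : ∃ ρ : Matrix Unit n R, ρ.map f = r * W' := by
    choose g hg using hf
    exact ⟨(r * W').map g, by ext; simp [hg]⟩
  have hU : IsUnit (fromBlocks (1 : Matrix Unit Unit R) ρ 0 V) := by
    refine isUnit_iff_exists.2 ⟨fromBlocks 1 (-(ρ * V')) 0 V', ?_, ?_⟩ <;>
      simp [Matrix.fromBlocks_multiply, hVV', hV'V, Matrix.mul_assoc]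
  have hW1 : IsUnit (fromBlocks (1 : Matrix Unit Unit S) 0 0 W) := by
    refine isUnit_iff_exists.2 ⟨fromBlocks 1 0 0 W', ?_, ?_⟩ <;>
      simp [Matrix.fromBlocks_multiply, hWW', hW'W]
  refine ⟨Y' * fromBlocks 1 ρ 0 V, fromBlocks 1 0 0 W,
    (isUnit_iff_exists.2 ⟨Y, hY'Y, hYY'⟩).mul hU, hW1, Matrix.isDiag_one.fromBlocks hdiag, ?_⟩
  have hX : X = f.mapMatrix Y' * M := by
    rw [hM, ← Matrix.mul_assoc, ← map_mul, hY'Y, map_one, Matrix.one_mul]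
  rw [hX, hMrD, hDVW, map_mul, Matrix.mul_assoc]
  congr 1
  simp [Matrix.fromBlocks_map, Matrix.fromBlocks_multiply, hρ, Matrix.mul_assoc, hW'W]

lemma liftsUpToDiag_of_subsingleton (n : Type*) [Fintype n] [DecidableEq n] [Subsingleton n]
    (f : R →+* S) : LiftsUpToDiag n f := fun X hX =>
  ⟨1, X, isUnit_one, hX, fun i j hij => (hij (Subsingleton.elim i j)).elim, by simp⟩

lemma liftsUpToDiag_fin (hR : IsLeftHermite R) {f : R →+* S} (hf : Function.Surjective f) :
    ∀ m : ℕ, LiftsUpToDiag (Fin m) f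
  | 0 => liftsUpToDiag_of_subsingleton _ f
  | 1 => liftsUpToDiag_of_subsingleton _ f
  | m + 2 => ((liftsUpToDiag_fin hR hf (m + 1)).sum hR hf).of_equiv
      ((Equiv.sumCongr (Equiv.ofUnique Unit (Fin 1)) (Equiv.refl _)).trans
        (finSumFinEquiv.trans (finCongr (Nat.add_comm 1 (m + 1)))))

end Lifting

section Main

variable {R : Type*} [Ring R]

/-- The congruence identifying `a` and `b` when `a * d = b * d`, for `d` with `R d ⊆ d R`. -/
def mulRightCon (d : R) (hd : ∀ r, ∃ r', r * d = d * r') : RingCon R where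
  r a b := a * d = b * d
  iseqv := ⟨fun _ => rfl, fun h => h.symm, fun h h' => h.trans h'⟩
  add' h h' := by rw [add_mul, add_mul, h, h']
  mul' {w x y z} h h' := by
    obtain ⟨r, hr⟩ := hd z
    rw [mul_assoc, h', hr, ← mul_assoc, h, mul_assoc, ← hr, mul_assoc]

lemma exists_mul_of_mem_span {d : R} (hd : ∀ r, ∃ r', r * d = d * r') {s : Set R}
    {I : TwoSidedIdeal R} (hs : ∀ x ∈ s, ∃ y ∈ I, x = d * y) {x : R}
    (hx : x ∈ TwoSidedIdeal.span s) : ∃ y ∈ I, x = d * y := by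
  induction hx using TwoSidedIdeal.span_induction with
  | mem x h => exact hs x h
  | zero => exact ⟨0, I.zero_mem, by simp⟩
  | add x y _ _ hx hy =>
    obtain ⟨a, ha, rfl⟩ := hx
    obtain ⟨b, hb, rfl⟩ := hy
    exact ⟨a + b, I.add_mem ha hb, by rw [mul_add]⟩
  | neg x _ hx =>
    obtain ⟨a, ha, rfl⟩ := hx
    exact ⟨-a, I.neg_mem ha, by simp⟩
  | left_absorb r x _ hx =>
    obtain ⟨a, ha, rfl⟩ := hx
    obtain ⟨r', hr'⟩ := hd r
    exact ⟨r' * a, I.mul_mem_left _ _ ha, by rw [← mul_assoc, hr', mul_assoc]⟩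
  | right_absorb r x _ hx =>
    obtain ⟨a, ha, rfl⟩ := hx
    exact ⟨a * r, I.mul_mem_right _ _ ha, by rw [mul_assoc]⟩

/-- Over a right Hermite ring with the D-property, every finitely generated two-sided ideal has a
common generator as a left and as a right ideal. -/
lemma exists_generator (hH : IsRightHermite R) (hD : DProp R) (s : Set R) (hs : s.Finite) :
    ∃ d : R, (∀ x : R, (∃ r, x = d * r) ↔ ∃ t, x = t * d) ∧
      (∀ a ∈ s, ∃ r, a = d * r) ∧ d ∈ TwoSidedIdeal.span s := by
  induction s, hs using Set.Finite.induction_on with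
  | empty =>
    exact ⟨0, by simp, by simp, zero_mem _⟩
  | @insert a s _ _ ih =>
    obtain ⟨d, -, hds, hd⟩ := ih
    obtain ⟨P, c, hP, hc⟩ := hH a d
    obtain ⟨P', hPP', -⟩ := isUnit_iff_exists.1 hP
    have hc' : Matrix.of ![![a, d]] = Matrix.of ![![c, 0]] * P' := by
      rw [← hc, Matrix.mul_assoc, hPP', Matrix.mul_one]
    have ha : a = c * P' 0 0 := by
      simpa [Matrix.mul_apply, Fin.sum_univ_two] using congrFun (congrFun hc' 0) 0
    have hdc : d = c * P' 0 1 := by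
      simpa [Matrix.mul_apply, Fin.sum_univ_two] using congrFun (congrFun hc' 0) 1
    have hcs : c ∈ TwoSidedIdeal.span (insert a s) := by
      have : a * P 0 0 + d * P 1 0 = c := by
        simpa [Matrix.mul_apply, Fin.sum_univ_two] using congrFun (congrFun hc 0) 0
      rw [← this]
      exact add_mem
        (TwoSidedIdeal.mul_mem_right _ _ _ (TwoSidedIdeal.subset_span (Set.mem_insert a s)))
        (TwoSidedIdeal.mul_mem_right _ _ _
          (TwoSidedIdeal.span_mono (Set.subset_insert a s) hd))
    obtain ⟨e, hce, he⟩ := hD c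
    obtain ⟨r, hr⟩ := (hce c).1 (TwoSidedIdeal.subset_span rfl)
    refine ⟨e, he, ?_, ?_⟩
    · rintro x (rfl | hx)
      · exact ⟨r * P' 0 0, by rw [← mul_assoc, ← hr, ← ha]⟩
      · obtain ⟨t, rfl⟩ := hds x hx
        exact ⟨r * P' 0 1 * t, by rw [← mul_assoc, ← mul_assoc, ← hr, ← hdc]⟩
    · exact TwoSidedIdeal.span_le.2 (Set.singleton_subset_iff.2 hcs)
        ((hce e).2 ⟨1, (mul_one e).symm⟩)

/-- The matrix is equivalent to a total divisor diagonal matrix. -/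
def AdmitsReduction {m n : ℕ} (A : Matrix (Fin m) (Fin n) R) : Prop :=
  ∃ (P : Matrix (Fin m) (Fin m) R) (Q : Matrix (Fin n) (Fin n) R),
    IsUnit P ∧ IsUnit Q ∧ IsTotalDivisorDiag (P * A * Q)

lemma admitsReduction_of_mul {m n : ℕ} {A : Matrix (Fin m) (Fin n) R}
    {P : Matrix (Fin m) (Fin m) R} {Q : Matrix (Fin n) (Fin n) R} (hP : IsUnit P)
    (hQ : IsUnit Q) (h : AdmitsReduction (P * A * Q)) : AdmitsReduction A := by
  obtain ⟨P', Q', hP', hQ', h⟩ := h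
  exact ⟨P' * P, Q * Q', hP'.mul hP, hQ.mul hQ', by simpa only [Matrix.mul_assoc] using h⟩

lemma exists_smul_eq_of_apply_eq_zero {m n : ℕ} {A : Matrix (Fin m) (Fin n) R} {d : R}
    (hd : ∀ r, ∃ r', r * d = d * r') (hA : ∀ i j, ∃ r, A i j = d * r) (hdA : d ∈ matStar A)
    {i₀ : Fin m} {j₀ : Fin n} (h₀ : A i₀ j₀ = 0) :
    ∃ B : Matrix (Fin m) (Fin n) R, A = d • B ∧ matStar B = ⊤ := by
  choose C hC using hA
  obtain ⟨B, hAB, hB₀⟩ : ∃ B : Matrix (Fin m) (Fin n) R, A = d • B ∧ B i₀ j₀ = 0 := by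
    refine ⟨of fun i j => if i = i₀ ∧ j = j₀ then 0 else C i j, ?_, by simp⟩
    ext i j
    by_cases h : i = i₀ ∧ j = j₀
    · simp [h.1, h.2, h₀]
    · simp [h, hC i j]
  obtain ⟨e, heB, he⟩ : ∃ e ∈ matStar B, d = d * e := by
    refine exists_mul_of_mem_span hd ?_ hdA
    rintro _ ⟨i, j, rfl⟩
    exact ⟨B i j, TwoSidedIdeal.subset_span ⟨i, j, rfl⟩, by simp [hAB]⟩
  have hde : d * (1 - e) = 0 := by rw [mul_sub, ← he, mul_one, sub_self]
  set B' : Matrix (Fin m) (Fin n) R := of fun i j => if i = i₀ ∧ j = j₀ then 1 - e else B i j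
    with hB'
  have hmem : ∀ i j, B' i j ∈ matStar B' := fun i j => TwoSidedIdeal.subset_span ⟨i, j, rfl⟩
  refine ⟨B', ?_, ?_⟩
  · ext i j
    by_cases h : i = i₀ ∧ j = j₀
    · simp [hB', h.1, h.2, h₀, hde]
    · simp [hB', h, hAB]
  · have hle : matStar B ≤ matStar B' := by
      refine TwoSidedIdeal.span_le.2 ?_
      rintro _ ⟨i, j, rfl⟩
      by_cases h : i = i₀ ∧ j = j₀
      · rw [h.1, h.2, hB₀]
        exact zero_mem _
      · have : B' i j = B i j := by simp [hB', h]
        exact this ▸ hmem i j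
    have h1 : 1 - e ∈ matStar B' := by
      simpa [hB'] using hmem i₀ j₀
    have : (1 : R) ∈ matStar B' := by
      have := add_mem h1 (hle heB)
      rwa [sub_add_cancel] at this
    exact TwoSidedIdeal.one_mem_iff _ |>.1 this

lemma isTotalDivisorDiag_diagonal_mul_smul {m n : ℕ} {D : Matrix (Fin m) (Fin n) R}
    (hDd : IsTotalDivisorDiag D) {d : R} (hd : ∀ x : R, (∃ r, x = d * r) ↔ ∃ t, x = t * d)
    {u v : Fin m → R} (huv : ∀ i, u i * v i * d = d) (hvu : ∀ i, v i * u i * d = d) :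
    IsTotalDivisorDiag (Matrix.diagonal u * (d • D)) := by
  have hl : ∀ r, ∃ r', r * d = d * r' := fun r => (hd (r * d)).2 ⟨r, rfl⟩
  have hr : ∀ r, ∃ r', d * r = r' * d := fun r => (hd (d * r)).1 ⟨r, rfl⟩
  have happ : ∀ i j, (Matrix.diagonal u * (d • D)) i j = u i * (d * D i j) := by
    intro i j
    simp [Matrix.diagonal_mul]
  refine ⟨fun i j hij => by rw [happ, hDd.1 i j hij, mul_zero, mul_zero], ?_⟩
  intro i j i' j' hij hij' hii' x hx
  rw [happ] at hx ⊢
  obtain ⟨y, hy, rfl⟩ : ∃ y ∈ TwoSidedIdeal.span {D i' j'}, x = d * y := by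
    refine exists_mul_of_mem_span hl ?_ hx
    rintro _ rfl
    obtain ⟨w, hw⟩ := hl (u i')
    exact ⟨w * D i' j', TwoSidedIdeal.mul_mem_left _ _ _ (TwoSidedIdeal.subset_span rfl),
      by rw [← mul_assoc, hw, mul_assoc]⟩
  constructor
  · obtain ⟨w, hw⟩ := hl (v i)
    obtain ⟨r, hr⟩ := (hDd.2 i j i' j' hij hij' hii' (w * y)
      (TwoSidedIdeal.mul_mem_left _ _ _ hy)).1
    refine ⟨r, ?_⟩
    calc d * y = u i * (v i * d) * y := by rw [← mul_assoc, huv]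
      _ = u i * d * (w * y) := by rw [hw]; simp only [mul_assoc]
      _ = _ := by rw [hr]; simp only [mul_assoc]
  · obtain ⟨t, rfl⟩ := (hDd.2 i j i' j' hij hij' hii' y hy).2
    obtain ⟨t', ht'⟩ := hr t
    refine ⟨t' * v i, ?_⟩
    calc d * (t * D i j) = t' * d * D i j := by rw [← mul_assoc, ht']
      _ = t' * (v i * u i * d) * D i j := by rw [hvu]
      _ = _ := by simp only [mul_assoc]

/-- Conjugating an invertible matrix past `d` yields an invertible matrix up to a diagonal
factor which is invertible modulo the left annihilator of `d`. -/
lemma exists_smul_eq_mul_diagonal (hH : IsLeftHermite R) {d : R}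
    (hl : ∀ r, ∃ r', r * d = d * r') (hd : ∀ r, ∃ r', d * r = r' * d) {m : ℕ}
    {V : Matrix (Fin m) (Fin m) R} (hV : IsUnit V) :
    ∃ (Y : Matrix (Fin m) (Fin m) R) (u v : Fin m → R), IsUnit Y ∧
      (∀ i, u i * v i * d = d) ∧ (∀ i, v i * u i * d = d) ∧
      ∀ i j, d * V i j = (Y * Matrix.diagonal u) i j * d := by
  obtain ⟨V', hVV', hV'V⟩ := isUnit_iff_exists.1 hV
  set f := (mulRightCon d hl).mk'
  have hf : ∀ a b, f a = f b ↔ a * d = b * d := fun a b => (mulRightCon d hl).eq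
  have hfs : Function.Surjective f := (mulRightCon d hl).mk'_surjective
  choose σ hσ using hd
  have hmul : ∀ A B : Matrix (Fin m) (Fin m) R, A * B = 1 →
      f.mapMatrix (A.map σ) * f.mapMatrix (B.map σ) = 1 := by
    intro A B hAB
    rw [← map_mul, ← map_one f.mapMatrix]
    ext i j
    rw [RingHom.mapMatrix_apply, RingHom.mapMatrix_apply, Matrix.map_apply, Matrix.map_apply, hf,
      Matrix.mul_apply, Finset.sum_mul]
    calc ∑ k, A.map σ i k * B.map σ k j * d = ∑ k, d * (A i k * B k j) := by
          refine Finset.sum_congr rfl fun k _ => ?_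
          rw [Matrix.map_apply, Matrix.map_apply, mul_assoc, ← hσ, ← mul_assoc, ← hσ, mul_assoc]
      _ = d * (1 : Matrix (Fin m) (Fin m) R) i j := by
          rw [← hAB, Matrix.mul_apply, Finset.mul_sum]
      _ = _ := by
          by_cases h : i = j <;> simp [Matrix.one_apply, h]
  obtain ⟨Y, W, hY, hW, hdiag, hVYW⟩ := liftsUpToDiag_fin hH hfs m (f.mapMatrix (V.map σ))
    (isUnit_iff_exists.2 ⟨f.mapMatrix (V'.map σ), hmul _ _ hVV', hmul _ _ hV'V⟩)
  obtain ⟨W', hWW', hW'W⟩ := isUnit_iff_exists.1 hW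
  obtain ⟨w, rfl⟩ : ∃ w, W = Matrix.diagonal w := ⟨W.diag, hdiag.diagonal_diag.symm⟩
  choose u hu using fun i => hfs (w i)
  choose v hv using fun i => hfs (W' i i)
  refine ⟨Y, u, v, hY, fun i => ?_, fun i => ?_, fun i j => ?_⟩
  · rw [← one_mul d, ← mul_assoc, mul_one, ← hf, map_mul, map_one, hu, hv]
    simpa using congrFun (congrFun hWW' i) i
  · rw [← one_mul d, ← mul_assoc, mul_one, ← hf, map_mul, map_one, hu, hv]
    simpa using congrFun (congrFun hW'W i) i
  · rw [hσ, ← hf]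
    have := congrFun (congrFun hVYW i) j
    simpa [hu] using this

lemma admitsReduction_of_apply_eq_zero (hH : IsHermiteRing R) (hD : DProp R)
    (h : ∀ (m n : ℕ) (A : Matrix (Fin m) (Fin n) R), matStar A = ⊤ → AdmitsReduction A)
    {m n : ℕ} {A : Matrix (Fin m) (Fin n) R} {i₀ : Fin m} {j₀ : Fin n} (h₀ : A i₀ j₀ = 0) :
    AdmitsReduction A := by
  obtain ⟨d, hd, hdA, hAd⟩ := exists_generator hH.1 hD {x : R | ∃ i j, A i j = x} (by
    have : {x : R | ∃ i j, A i j = x} = Set.range fun p : Fin m × Fin n => A p.1 p.2 := by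
      ext; simp
    rw [this]
    exact Set.finite_range _)
  have hl : ∀ r, ∃ r', r * d = d * r' := fun r => (hd (r * d)).2 ⟨r, rfl⟩
  have hr : ∀ r, ∃ r', d * r = r' * d := fun r => (hd (d * r)).1 ⟨r, rfl⟩
  obtain ⟨B, rfl, hB⟩ :=
    exists_smul_eq_of_apply_eq_zero hl (fun i j => hdA _ ⟨i, j, rfl⟩) hAd h₀
  obtain ⟨P, Q, hP, hQ, hPBQ⟩ := h m n B hB
  obtain ⟨V, hPV, hVP⟩ := isUnit_iff_exists.1 hP
  obtain ⟨Y, u, v, hY, huv, hvu, hYu⟩ :=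
    exists_smul_eq_mul_diagonal hH.2 hl hr (isUnit_iff_exists.2 ⟨P, hVP, hPV⟩)
  obtain ⟨Y', hYY', hY'Y⟩ := isUnit_iff_exists.1 hY
  refine ⟨Y', Q, isUnit_iff_exists.2 ⟨Y, hY'Y, hYY'⟩, hQ, ?_⟩
  have hBQ : d • (B * Q) = Y * Matrix.diagonal u * (d • (P * B * Q)) := by
    have : B * Q = V * (P * B * Q) := by
      rw [← Matrix.mul_assoc, ← Matrix.mul_assoc, hVP, Matrix.one_mul]
    conv_lhs => rw [this]
    ext i j
    rw [Matrix.smul_apply, Matrix.mul_apply, Matrix.mul_apply, smul_eq_mul, Finset.mul_sum]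
    refine Finset.sum_congr rfl fun k _ => ?_
    rw [Matrix.smul_apply, smul_eq_mul, ← mul_assoc, ← mul_assoc, hYu]
  have : Y' * (d • B) * Q = Matrix.diagonal u * (d • (P * B * Q)) := by
    rw [Matrix.mul_assoc, Matrix.smul_mul, hBQ, Matrix.mul_assoc, ← Matrix.mul_assoc, hY'Y,
      Matrix.one_mul]
  rw [this]
  exact isTotalDivisorDiag_diagonal_mul_smul hPBQ hd huv hvu

lemma isEDRing_of_forall_matStar_eq_top (hH : IsHermiteRing R) (hD : DProp R)
    (h : ∀ (m n : ℕ) (A : Matrix (Fin m) (Fin n) R), matStar A = ⊤ → AdmitsReduction A) :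
    IsEDRing R := by
  intro m n A
  change AdmitsReduction A
  by_cases hm : ∃ i i' : Fin m, i ≠ i' ∧ Nonempty (Fin n)
  · obtain ⟨i, i', hii', ⟨j⟩⟩ := hm
    obtain ⟨Y, hY, hY0⟩ := exists_isUnit_mulVec_eq_zero hH.2 i (fun a => A a j)
    refine admitsReduction_of_mul hY isUnit_one
      (admitsReduction_of_apply_eq_zero hH hD h (i₀ := i') (j₀ := j) ?_)
    rw [Matrix.mul_one]
    exact hY0 i' hii'.symm
  by_cases hn : ∃ j j' : Fin n, j ≠ j' ∧ Nonempty (Fin m)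
  · obtain ⟨j, j', hjj', ⟨i⟩⟩ := hn
    obtain ⟨Q, c, hQ, hc⟩ := hH.1 (A i j) (A i j')
    refine admitsReduction_of_mul isUnit_one (isUnit_planeMatrix hjj' hQ)
      (admitsReduction_of_apply_eq_zero hH hD h (i₀ := i) (j₀ := j') ?_)
    rw [Matrix.one_mul]
    refine (vecMul_planeMatrix_right hjj' Q (A i)).trans ?_
    simpa [Matrix.mul_apply, Matrix.vecMul, dotProduct, Fin.sum_univ_two] using
      congrFun (congrFun hc 0) 1
  push Not at hm hn
  refine ⟨1, 1, isUnit_one, isUnit_one, fun i j hij => ?_, fun i j i' j' _ _ hii' => ?_⟩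
  · have hm1 : ∀ a b : Fin m, a = b := fun a b => by
      by_contra hab
      exact (hm a b hab).false j
    have hn1 : ∀ a b : Fin n, a = b := fun a b => by
      by_contra hab
      exact (hn a b hab).false i
    have h1 := congrArg Fin.val (hm1 i ⟨0, i.pos⟩)
    have h2 := congrArg Fin.val (hn1 j ⟨0, j.pos⟩)
    exact (hij (h1.trans h2.symm)).elim
  · exact ((hm i i' (fun h => by simp [h] at hii')).false j).elim

end Main

end HermiteReduction

/-- A Hermite ring with the D-property is an elementary divisor ring iff
every matrix `A` with `A_* = R` admits a diagonal reduction. -/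
theorem stmt16 {R : Type*} [Ring R] [Nontrivial R]
    (hH : IsHermiteRing R) (hD : DProp R) :
    IsEDRing R ↔
      ∀ (m n : ℕ) (A : Matrix (Fin m) (Fin n) R), matStar A = ⊤ →
        ∃ (P : Matrix (Fin m) (Fin m) R) (Q : Matrix (Fin n) (Fin n) R),
          IsUnit P ∧ IsUnit Q ∧ IsTotalDivisorDiag (P * A * Q) :=
  ⟨fun h m n A _ => h m n A, HermiteReduction.isEDRing_of_forall_matStar_eq_top hH hD⟩
end

section
/- Let R be a domain with the D-property. Then every nonzero element a ∈ R can be written in the form a = αb = cα, where α is a duo element of R with RaR = αR = Rα, and b, c ∈ R satisfy RbR = R and RcR = R. -/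
open Matrix

/-- If `Rα ⊆ αR` and `α ∈ R(αb)R`, then `α = α * y` for some `y ∈ RbR`. -/
theorem exists_mem_span_eq_mul_left {R : Type*} [Ring R] {α b : R}
    (hα : ∀ r : R, ∃ s, r * α = α * s) (h : α ∈ TwoSidedIdeal.span {α * b}) :
    ∃ y ∈ TwoSidedIdeal.span {b}, α = α * y := by
  let J : TwoSidedIdeal R := TwoSidedIdeal.mk'
    {x | ∃ y ∈ TwoSidedIdeal.span {b}, x = α * y}
    ⟨0, TwoSidedIdeal.zero_mem _, by simp⟩
    (by
      rintro _ _ ⟨y, hy, rfl⟩ ⟨z, hz, rfl⟩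
      exact ⟨y + z, TwoSidedIdeal.add_mem _ hy hz, (mul_add _ _ _).symm⟩)
    (by
      rintro _ ⟨y, hy, rfl⟩
      exact ⟨-y, TwoSidedIdeal.neg_mem _ hy, by simp⟩)
    (by
      rintro r _ ⟨y, hy, rfl⟩
      obtain ⟨s, hs⟩ := hα r
      exact ⟨s * y, TwoSidedIdeal.mul_mem_left _ _ _ hy, by
        rw [← mul_assoc, hs, mul_assoc]⟩)
    (by
      rintro _ r ⟨y, hy, rfl⟩
      exact ⟨y * r, TwoSidedIdeal.mul_mem_right _ _ _ hy, mul_assoc _ _ _⟩)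
  have hJ (x : R) : x ∈ J ↔ ∃ y ∈ TwoSidedIdeal.span {b}, x = α * y :=
    TwoSidedIdeal.mem_mk' _ _ _ _ _ _ _
  refine (hJ α).1 (TwoSidedIdeal.mem_span_iff.1 h J ?_)
  rintro _ rfl
  exact (hJ _).2 ⟨b, TwoSidedIdeal.subset_span rfl, rfl⟩

/-- If `αR ⊆ Rα` and `α ∈ R(bα)R`, then `α = y * α` for some `y ∈ RbR`. -/
theorem exists_mem_span_eq_mul_right {R : Type*} [Ring R] {α b : R}
    (hα : ∀ r : R, ∃ s, α * r = s * α) (h : α ∈ TwoSidedIdeal.span {b * α}) :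
    ∃ y ∈ TwoSidedIdeal.span {b}, α = y * α := by
  let J : TwoSidedIdeal R := TwoSidedIdeal.mk'
    {x | ∃ y ∈ TwoSidedIdeal.span {b}, x = y * α}
    ⟨0, TwoSidedIdeal.zero_mem _, by simp⟩
    (by
      rintro _ _ ⟨y, hy, rfl⟩ ⟨z, hz, rfl⟩
      exact ⟨y + z, TwoSidedIdeal.add_mem _ hy hz, (add_mul _ _ _).symm⟩)
    (by
      rintro _ ⟨y, hy, rfl⟩
      exact ⟨-y, TwoSidedIdeal.neg_mem _ hy, by simp⟩)
    (by
      rintro r _ ⟨y, hy, rfl⟩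
      exact ⟨r * y, TwoSidedIdeal.mul_mem_left _ _ _ hy, (mul_assoc _ _ _).symm⟩)
    (by
      rintro _ r ⟨y, hy, rfl⟩
      obtain ⟨s, hs⟩ := hα r
      exact ⟨y * s, TwoSidedIdeal.mul_mem_right _ _ _ hy, by
        rw [mul_assoc, hs, mul_assoc]⟩)
  have hJ (x : R) : x ∈ J ↔ ∃ y ∈ TwoSidedIdeal.span {b}, x = y * α :=
    TwoSidedIdeal.mem_mk' _ _ _ _ _ _ _
  refine (hJ α).1 (TwoSidedIdeal.mem_span_iff.1 h J ?_)
  rintro _ rfl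
  exact (hJ _).2 ⟨b, TwoSidedIdeal.subset_span rfl, rfl⟩

/-- In a domain with the D-property, every nonzero `a` can be written
`a = αb = cα` with `α` duo, `RaR = αR = Rα`, and `RbR = R`, `RcR = R`. -/
theorem stmt17 {R : Type*} [Ring R] [IsDomain R] (hD : DProp R) :
    ∀ a : R, a ≠ 0 →
      ∃ α b c : R,
        a = α * b ∧ a = c * α ∧ IsDuoElem α ∧
        (∀ x : R, x ∈ TwoSidedIdeal.span {a} ↔ ∃ r, x = α * r) ∧
        (∀ x : R, (∃ r, x = α * r) ↔ ∃ s, x = s * α) ∧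
        TwoSidedIdeal.span {b} = ⊤ ∧ TwoSidedIdeal.span {c} = ⊤ := by
  intro a ha
  obtain ⟨α, hspan, hduo⟩ := hD a
  have ha_mem : a ∈ TwoSidedIdeal.span {a} := TwoSidedIdeal.subset_span rfl
  have hα_mem : α ∈ TwoSidedIdeal.span {a} := (hspan α).2 ⟨1, (mul_one α).symm⟩
  obtain ⟨b, hb⟩ := (hspan a).1 ha_mem
  obtain ⟨c, hc⟩ := (hduo a).1 ⟨b, hb⟩
  have hα : α ≠ 0 := by
    rintro rfl
    exact ha (by simpa using hb)
  refine ⟨α, b, c, hb, hc, ⟨hα, hduo⟩, hspan, hduo, ?_, ?_⟩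
  · obtain ⟨y, hy, hαy⟩ := exists_mem_span_eq_mul_left
      (fun r => (hduo _).2 ⟨r, rfl⟩) (hb ▸ hα_mem)
    apply TwoSidedIdeal.eq_top
    rwa [(mul_eq_left₀ hα).1 hαy.symm] at hy
  · obtain ⟨y, hy, hαy⟩ := exists_mem_span_eq_mul_right
      (fun r => (hduo _).1 ⟨r, rfl⟩) (hc ▸ hα_mem)
    apply TwoSidedIdeal.eq_top
    rwa [(mul_eq_right₀ hα).1 hαy.symm] at hy
end
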